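/- For every ω ∈ U the operator ρ(ω) is antisymmetric with respect to B, i.e. B(ρ(ω)X, Y) = −B(X, ρ(ω)Y) for all X, Y ∈ 𝔊, and ρ is 𝔊₀-equivariant: for every T ∈ 𝔊₀ and ω ∈ U, (∇_{[T,ω]}ρ)(ω) = (ad T)∘ρ(ω) − ρ(ω)∘(ad T). -/

import Mathlib

open Complex

/-- The hyperbolic cotangent `coth u = cosh u / sinh u`. -/
noncomputable def coth (u : ℂ) : ℂ := Complex.cosh u / Complex.sinh u

open Topology

section Coth

theorem coth_neg (u : ℂ) : coth (-u) = -coth u := by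
  simp [coth, div_neg]

theorem coth_add_nat_mul_pi_mul_I (u : ℂ) (n : ℕ) : coth (u + n * (Real.pi * I)) = coth u := by
  induction n with
  | zero => simp
  | succ k ih =>
    rw [← ih]
    have h : u + ((k + 1 : ℕ) : ℂ) * (Real.pi * I) = (u + k * (Real.pi * I)) + Real.pi * I := by
      push_cast; ring
    have hcosh (v : ℂ) : Complex.cosh (v + Real.pi * I) = -Complex.cosh v := by
      simp [Complex.cosh_add, Complex.cosh_mul_I, Complex.sinh_mul_I]
    have hsinh (v : ℂ) : Complex.sinh (v + Real.pi * I) = -Complex.sinh v := by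
      simp [Complex.sinh_add, Complex.cosh_mul_I, Complex.sinh_mul_I]
    rw [h, coth, hcosh, hsinh, neg_div_neg_eq, coth]

theorem coth_shift_reflect {N : ℕ} (hN : N ≠ 0) (q a b : ℕ) (hab : a + b = N) (w : ℂ) :
    coth ((w + (2 * (Real.pi : ℂ) * I / (N : ℂ)) * q * b) / 2) =
      -coth ((-w + (2 * (Real.pi : ℂ) * I / (N : ℂ)) * q * a) / 2) := by
  have hN' : (N : ℂ) ≠ 0 := by exact_mod_cast hN
  have hb : (b : ℂ) = N - a := by rw [← hab]; push_cast; ring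
  rw [← coth_neg, ← coth_add_nat_mul_pi_mul_I (-_) q]
  congr 1
  rw [hb]
  field_simp
  ring

end Coth

section PowerSeries

/-- A scalar power series whose sum vanishes on a punctured disc has zero coefficients. -/
theorem coeff_eq_zero_of_hasSum_zero {d : ℕ → ℂ} {r : ℝ} (hr : 0 < r)
    (h : ∀ w : ℂ, ‖w‖ < r → w ≠ 0 → HasSum (fun n => d n * w ^ n) 0) (n : ℕ) : d n = 0 := by
  have h0 : HasSum (fun n => d n * (0 : ℂ) ^ n) (d 0) := by
    simpa using hasSum_single (f := fun n => d n * (0 : ℂ) ^ n) 0 (by simp +contextual)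
  classical
  have hball : ∀ᶠ w : ℂ in 𝓝 0, ‖w‖ < r := by
    filter_upwards [Metric.ball_mem_nhds (0 : ℂ) hr] with w hw using by simpa using hw
  have hps : HasFPowerSeriesAt (fun w : ℂ => if w = 0 then d 0 else 0)
      (FormalMultilinearSeries.ofScalars ℂ d) 0 := by
    rw [hasFPowerSeriesAt_iff]
    filter_upwards [hball] with w hw
    by_cases hw0 : w = 0
    · subst hw0
      simpa [FormalMultilinearSeries.coeff_ofScalars, mul_comm] using h0
    · simpa [FormalMultilinearSeries.coeff_ofScalars, mul_comm, hw0] using h w hw hw0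
  have hd0 : d 0 = 0 := by
    have h1 : Filter.Tendsto (fun w : ℂ => if w = 0 then d 0 else 0) (𝓝[≠] 0) (𝓝 (d 0)) := by
      simpa using hps.continuousAt.tendsto.mono_left nhdsWithin_le_nhds
    have h2 : Filter.Tendsto (fun w : ℂ => if w = 0 then d 0 else 0) (𝓝[≠] 0) (𝓝 0) := by
      refine tendsto_const_nhds.congr' ?_
      filter_upwards [self_mem_nhdsWithin] with w hw
      simp [show w ≠ 0 from hw]
    exact tendsto_nhds_unique h1 h2
  have hz := hps.eq_zero_of_eventually (Filter.Eventually.of_forall fun w => by simp [hd0])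
  rw [FormalMultilinearSeries.ofScalars_series_eq_zero] at hz
  exact congrFun hz n

/-- If `∑ dₙ wⁿ = -∑ cₙ (-w)ⁿ` on a punctured disc, then `dₙ = -(-1)ⁿ cₙ`. -/
theorem coeff_reflection {c d : ℕ → ℂ} {f g : ℂ → ℂ} {r : ℝ} (hr : 0 < r)
    (hc : ∀ w : ℂ, ‖w‖ < r → w ≠ 0 → HasSum (fun n => c n * w ^ n) (f w))
    (hd : ∀ w : ℂ, ‖w‖ < r → w ≠ 0 → HasSum (fun n => d n * w ^ n) (g w))
    (hfg : ∀ w, g w = -f (-w)) (n : ℕ) : c n * (-1) ^ n + d n = 0 := by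
  refine coeff_eq_zero_of_hasSum_zero hr (d := fun n => c n * (-1) ^ n + d n) ?_ n
  intro w hw hw0
  have h := (hc (-w) (by simpa using hw) (neg_ne_zero.2 hw0)).add (hd w hw hw0)
  rw [hfg, add_neg_cancel] at h
  refine h.congr_fun fun k => ?_
  rw [neg_pow w k]
  ring

variable {𝔸 : Type*} [NormedRing 𝔸] [NormedAlgebra ℂ 𝔸] [NormOneClass 𝔸] [CompleteSpace 𝔸]

theorem hasFPowerSeriesOnBall_ofScalarsSum {c : ℕ → ℂ} {r : ℝ} (hr : 0 < r)
    (hc : ∀ w : ℂ, ‖w‖ < r → w ≠ 0 → Summable fun n => ‖c n * w ^ n‖) :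
    HasFPowerSeriesOnBall (FormalMultilinearSeries.ofScalarsSum (E := 𝔸) c)
      (FormalMultilinearSeries.ofScalars 𝔸 c) 0 (ENNReal.ofReal r) := by
  have hrad : ENNReal.ofReal r ≤ (FormalMultilinearSeries.ofScalars 𝔸 c).radius := by
    refine ENNReal.le_of_forall_nnreal_lt fun s hs => ?_
    rcases eq_or_ne s 0 with rfl | hs0
    · simp
    apply FormalMultilinearSeries.le_radius_of_summable
    have hsr : (s : ℝ) < r := by
      rw [← ENNReal.ofReal_coe_nnreal] at hs
      exact (ENNReal.ofReal_lt_ofReal_iff hr).1 hs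
    have := hc ((s : ℝ) : ℂ) (by simpa using hsr) (by simpa using hs0)
    simpa [FormalMultilinearSeries.ofScalars_norm] using this
  have hr' : 0 < ENNReal.ofReal r := ENNReal.ofReal_pos.2 hr
  exact (FormalMultilinearSeries.hasFPowerSeriesOnBall _ (hr'.trans_le hrad)).mono hr' hrad

theorem hasSum_ofScalarsSum {c : ℕ → ℂ} {r : ℝ} (hr : 0 < r)
    (hc : ∀ w : ℂ, ‖w‖ < r → w ≠ 0 → Summable fun n => ‖c n * w ^ n‖) {A : 𝔸} (hA : ‖A‖ < r) :
    HasSum (fun n => c n • A ^ n) (FormalMultilinearSeries.ofScalarsSum c A) := by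
  have := (hasFPowerSeriesOnBall_ofScalarsSum (𝔸 := 𝔸) hr hc).hasSum (y := A)
    (by rw [Metric.eball_ofReal]; simpa using hA)
  simpa [FormalMultilinearSeries.ofScalars_apply_eq] using this

/-- The derivative of a power series function along a commutator direction `[M, A]` is the
commutator of `M` with its value at `A`. -/
theorem hasDerivAt_ofScalarsSum_commutator {c : ℕ → ℂ} {r : ℝ} (hr : 0 < r)
    (hc : ∀ w : ℂ, ‖w‖ < r → w ≠ 0 → Summable fun n => ‖c n * w ^ n‖) {A : 𝔸} (hA : ‖A‖ < r)
    (M : 𝔸) :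
    HasDerivAt (fun t : ℂ => FormalMultilinearSeries.ofScalarsSum c (A + t • (M * A - A * M)))
      (M * FormalMultilinearSeries.ofScalarsSum c A -
        FormalMultilinearSeries.ofScalarsSum c A * M) 0 := by
  set F : 𝔸 → 𝔸 := FormalMultilinearSeries.ofScalarsSum c
  have hdiff : DifferentiableAt ℂ F A :=
    ((hasFPowerSeriesOnBall_ofScalarsSum hr hc).analyticAt_of_mem
      (by rw [Metric.eball_ofReal]; simpa using hA)).differentiableAt
  let e : ℂ → 𝔸 := fun t => NormedSpace.exp (t • M)
  let e' : ℂ → 𝔸 := fun t => NormedSpace.exp (t • -M)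
  have he : HasDerivAt e M 0 := by
    simpa using hasDerivAt_exp_smul_const (𝕂 := ℂ) M (0 : ℂ)
  have he' : HasDerivAt e' (-M) 0 := by
    simpa [e'] using hasDerivAt_exp_smul_const (𝕂 := ℂ) (-M) (0 : ℂ)
  have he0 : e 0 = 1 := by simp [e]
  have he0' : e' 0 = 1 := by simp [e']
  have hinv : ∀ t, e' t * e t = 1 := fun t => by
    let : NormedAlgebra ℚ 𝔸 := NormedAlgebra.restrictScalars ℚ ℂ 𝔸
    have hcomm : Commute (t • -M) (t • M) := by
      simp
    simp only [e, e']
    rw [← NormedSpace.exp_add_of_commute hcomm]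
    simp
  have hinv' : ∀ t, e t * e' t = 1 := fun t => by
    let : NormedAlgebra ℚ 𝔸 := NormedAlgebra.restrictScalars ℚ ℂ 𝔸
    have hcomm : Commute (t • M) (t • -M) := by
      simp
    simp only [e, e']
    rw [← NormedSpace.exp_add_of_commute hcomm]
    simp
  have hconj : ∀ X : 𝔸, HasDerivAt (fun t => e t * X * e' t) (M * X - X * M) 0 := fun X => by
    have := (he.mul_const X).mul he'
    simpa [he0, he0', sub_eq_add_neg, Pi.mul_def] using this
  have hpow : ∀ t (n : ℕ), (e t * A * e' t) ^ n * e t = e t * A ^ n := fun t n => by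
    induction n with
    | zero => simp
    | succ k ih =>
      calc (e t * A * e' t) ^ (k + 1) * e t
          = (e t * A * e' t) ^ k * e t * A * (e' t * e t) := by rw [pow_succ]; simp only [mul_assoc]
        _ = e t * A ^ (k + 1) := by rw [hinv, ih, mul_one, pow_succ, mul_assoc]
  have hev : (fun t => F (e t * A * e' t)) =ᶠ[𝓝 0] fun t => e t * F A * e' t := by
    have hcont := (hconj A).continuousAt.norm
    have : ∀ᶠ t in 𝓝 (0 : ℂ), ‖e t * A * e' t‖ < r :=
      hcont.eventually_lt continuousAt_const (by simpa [he0, he0'] using hA)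
    filter_upwards [this] with t ht
    have h1 := hasSum_ofScalarsSum hr hc ht
    have h2 := ((hasSum_ofScalarsSum hr hc hA).mul_left (e t)).mul_right (e' t)
    refine h1.unique (h2.congr_fun ?_)
    intro n
    rw [mul_smul_comm, smul_mul_assoc, ← hpow, mul_assoc _ (e t) (e' t), hinv', mul_one]
  have hFe : HasFDerivAt F (fderiv ℂ F A) (e 0 * A * e' 0) := by
    rw [he0, he0', one_mul, mul_one]
    exact hdiff.hasFDerivAt
  have hFl : HasFDerivAt F (fderiv ℂ F A) (A + (0 : ℂ) • (M * A - A * M)) := by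
    rw [zero_smul, add_zero]
    exact hdiff.hasFDerivAt
  have h1 : HasDerivAt (fun t => F (e t * A * e' t)) (fderiv ℂ F A (M * A - A * M)) 0 :=
    hFe.comp_hasDerivAt (0 : ℂ) (hconj A)
  have h2 := (hconj (F A)).congr_of_eventuallyEq hev
  rw [← h1.unique h2]
  refine hFl.comp_hasDerivAt (0 : ℂ) ?_
  simpa using ((hasDerivAt_id (0 : ℂ)).smul_const (M * A - A * M)).const_add A

end PowerSeries

/-- A vector space with a finite order automorphism is spanned by its eigenvectors. -/
theorem induction_on_eigenvectors {G : Type*} [AddCommGroup G] [Module ℂ G] (μ : G ≃ₗ[ℂ] G)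
    {N : ℕ} (hμN : ∀ x, (⇑μ)^[N] x = x) {ζ : ℂ} (hζ : IsPrimitiveRoot ζ N) (hN : N ≠ 0)
    {P : G → Prop} (h0 : P 0) (hadd : ∀ x y, P x → P y → P (x + y))
    (heig : ∀ a < N, ∀ x, μ x = ζ ^ a • x → P x) (x : G) : P x := by
  have hζ0 : ζ ≠ 0 := hζ.ne_zero hN
  let p : ℕ → G := fun a => ∑ k ∈ Finset.range N, ((ζ⁻¹) ^ (a * k)) • (⇑μ)^[k] ((N : ℂ)⁻¹ • x)
  have hp : ∀ a, μ (p a) = ζ ^ a • p a := fun a => by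
    let g : ℕ → G := fun k => (ζ ^ a * (ζ⁻¹) ^ (a * k)) • (⇑μ)^[k] ((N : ℂ)⁻¹ • x)
    have h1 : μ (p a) = ∑ k ∈ Finset.range N, g (k + 1) := by
      simp only [p, map_sum, map_smul, g]
      refine Finset.sum_congr rfl fun k _ => ?_
      rw [Function.iterate_succ_apply']
      congr 1
      rw [mul_add, pow_add, mul_one, mul_left_comm, ← mul_pow, mul_inv_cancel₀ hζ0]
      simp
    have h2 : ζ ^ a • p a = ∑ k ∈ Finset.range N, g k := by
      simp only [p, Finset.smul_sum, smul_smul, g]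
    have h3 : g N = g 0 := by
      have : ζ⁻¹ ^ (a * N) = 1 := by rw [mul_comm, pow_mul, hζ.inv.pow_eq_one, one_pow]
      simp only [g, hμN, this]
      simp
    rw [h1, h2]
    have := Finset.sum_range_succ g N
    rw [Finset.sum_range_succ', h3] at this
    exact add_right_cancel this
  have hsum : ∑ a ∈ Finset.range N, p a = x := by
    simp only [p]
    rw [Finset.sum_comm, Finset.sum_eq_single_of_mem 0 (Finset.mem_range.2 hN.bot_lt)]
    · simp [← Nat.cast_smul_eq_nsmul ℂ, smul_smul, hN]
    · intro k hk hk0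
      rw [← Finset.sum_smul]
      have hk1 : (ζ⁻¹) ^ k ≠ 1 :=
        hζ.inv.pow_ne_one_of_pos_of_lt hk0 (Finset.mem_range.1 hk)
      have : ∑ a ∈ Finset.range N, (ζ⁻¹) ^ (a * k) = 0 := by
        simp only [mul_comm _ k, pow_mul]
        rw [geom_sum_eq hk1, ← pow_mul, mul_comm, pow_mul, hζ.inv.pow_eq_one]
        simp
      rw [this, zero_smul]
  rw [← hsum]
  exact Finset.sum_induction _ P hadd h0 fun a ha => heig a (Finset.mem_range.1 ha) _ (hp a)

/-- (Appendix B of the paper, continued.)  In the setting of the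
dynamical r-matrix `ρ = ρ_q` associated with a finite order, scalar-product-preserving
automorphism `μ` of a finite-dimensional self-dual complex Lie algebra `𝔊`: for every
`ω ∈ U = {ω ∈ 𝔊₀ : ‖ad ω‖ < r}` the operator `ρ(ω)` is antisymmetric with respect to
`B`, i.e. `B(ρ(ω)X, Y) = −B(X, ρ(ω)Y)` for all `X, Y ∈ 𝔊`, and `ρ` is
`𝔊₀`-equivariant: for every `T ∈ 𝔊₀` and `ω ∈ U`,
`(∇_{[T,ω]}ρ)(ω) = (ad T)∘ρ(ω) − ρ(ω)∘(ad T)`. -/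
theorem rho_q_antisymmetric_equivariant {G : Type*} [NormedAddCommGroup G]
    [NormedSpace ℂ G] [FiniteDimensional ℂ G]
    (bracket : G →L[ℂ] G →L[ℂ] G)
    (halt : ∀ x : G, bracket x x = 0)
    (hleib : ∀ x y z : G,
      bracket x (bracket y z) = bracket (bracket x y) z + bracket y (bracket x z))
    (B : G →ₗ[ℂ] G →ₗ[ℂ] ℂ)
    (hBsymm : ∀ x y, B x y = B y x)
    (hBnd : ∀ x, (∀ y, B x y = 0) → x = 0)
    (hBinv : ∀ x y z, B (bracket x y) z + B y (bracket x z) = 0)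
    (N : ℕ) (hN : 2 ≤ N)
    (μ : G ≃ₗ[ℂ] G) (hμN : ∀ x, (⇑μ)^[N] x = x)
    (hμbr : ∀ x y, μ (bracket x y) = bracket (μ x) (μ y))
    (hμB : ∀ x y, B (μ x) (μ y) = B x y)
    (ζ : ℂ) (hζ : ζ = Complex.exp (2 * (Real.pi : ℂ) * I / (N : ℂ)))
    (hG0 : ∃ x : G, x ≠ 0 ∧ μ x = x)
    (q : ℕ) (hq1 : 1 ≤ q) (hq2 : q ≤ N - 1)
    (hq : ∀ a : ℕ, 1 ≤ a → a < N → (∃ ξ : G, ξ ≠ 0 ∧ μ ξ = ζ ^ a • ξ) → ¬ (N ∣ q * a))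
    (r : ℝ) (hr : 0 < r) (c : ℕ → ℕ → ℂ)
    (hc : ∀ a : ℕ, a < N → (∃ ξ : G, ξ ≠ 0 ∧ μ ξ = ζ ^ a • ξ) →
      ∀ w : ℂ, ‖w‖ < r → (a = 0 → w ≠ 0) →
        Summable (fun n : ℕ => ‖c a n * w ^ n‖) ∧
        ∑' n : ℕ, c a n * w ^ n =
          if a = 0 then (1 / 2 : ℂ) * coth (w / 2) - 1 / w
          else (1 / 2 : ℂ) * coth ((w + (2 * (Real.pi : ℂ) * I / (N : ℂ)) * q * a) / 2))
    (ρ : G → G →L[ℂ] G)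
    (hρ : ∀ ω : G, μ ω = ω → ‖bracket ω‖ < r → ∀ a : ℕ, a < N →
      ∀ ξ : G, μ ξ = ζ ^ a • ξ →
        HasSum (fun n : ℕ => c a n • ((bracket ω ^ n) ξ)) (ρ ω ξ))
    (Dρ : G → G → G → G)
    (hDρ : ∀ T : G, μ T = T → ∀ ω : G, μ ω = ω → ‖bracket ω‖ < r → ∀ X : G,
      HasDerivAt (fun t : ℂ => ρ (ω + t • T) X) (Dρ T ω X) 0) :
    (∀ ω : G, μ ω = ω → ‖bracket ω‖ < r → ∀ X Y : G,
        B (ρ ω X) Y = -B X (ρ ω Y)) ∧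
    (∀ T : G, μ T = T → ∀ ω : G, μ ω = ω → ‖bracket ω‖ < r → ∀ X : G,
        Dρ (bracket T ω) ω X = bracket T (ρ ω X) - ρ ω (bracket T X)) := by
  have hN0 : N ≠ 0 := by omega
  have hζp : IsPrimitiveRoot ζ N := hζ ▸ Complex.isPrimitiveRoot_exp N hN0
  obtain ⟨x₀, hx₀, -⟩ := hG0
  have : Nontrivial G := ⟨x₀, 0, hx₀⟩
  have : CompleteSpace G := FiniteDimensional.complete ℂ G
  have hpow_eig : ∀ ω, μ ω = ω → ∀ (a : ℕ) X, μ X = ζ ^ a • X → ∀ n : ℕ,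
      μ ((bracket ω ^ n) X) = ζ ^ a • (bracket ω ^ n) X := by
    intro ω hω a X hX n
    induction n with
    | zero => simpa using hX
    | succ k ih =>
      rw [pow_succ', mul_apply_eq_comp, hμbr, hω, ih, map_smul]
  have hBpow : ∀ ω (n : ℕ) X Y,
      B ((bracket ω ^ n) X) Y = (-1) ^ n * B X ((bracket ω ^ n) Y) := by
    intro ω n
    induction n with
    | zero => simp
    | succ k ih =>
      intro X Y
      rw [pow_succ, mul_apply_eq_comp, ih, eq_neg_of_add_eq_zero_left (hBinv ω X _),
        ← mul_apply_eq_comp, ← pow_succ', pow_succ (-1 : ℂ), pow_succ]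
      ring
  have hsum : ∀ a < N, (∃ ξ : G, ξ ≠ 0 ∧ μ ξ = ζ ^ a • ξ) → ∀ w : ℂ, ‖w‖ < r → w ≠ 0 →
      HasSum (fun n => c a n * w ^ n) (if a = 0 then (1 / 2 : ℂ) * coth (w / 2) - 1 / w
        else (1 / 2 : ℂ) * coth ((w + (2 * (Real.pi : ℂ) * I / (N : ℂ)) * q * a) / 2)) := by
    intro a ha hξ w hw hw0
    obtain ⟨h1, h2⟩ := hc a ha hξ w hw fun _ => hw0
    rw [← h2]
    exact h1.of_norm.hasSum
  have hantisymm_eig : ∀ ω, μ ω = ω → ‖bracket ω‖ < r → ∀ a < N, ∀ X, μ X = ζ ^ a • X →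
      ∀ b < N, ∀ Y, μ Y = ζ ^ b • Y → B (ρ ω X) Y = -B X (ρ ω Y) := by
    intro ω hω hωr a ha X hX b hb Y hY
    by_cases hX0 : X = 0
    · simp [hX0]
    by_cases hY0 : Y = 0
    · simp [hY0]
    have hsX := (LinearMap.toContinuousLinearMap (B.flip Y)).hasSum (hρ ω hω hωr a ha X hX)
    have hsY := ((LinearMap.toContinuousLinearMap (B X)).hasSum (hρ ω hω hωr b hb Y hY)).neg
    refine hsX.unique (hsY.congr_fun fun n => ?_)
    simp only [LinearMap.coe_toContinuousLinearMap', LinearMap.flip_apply, map_smul,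
      smul_eq_mul, hBpow]
    suffices h : (c a n * (-1) ^ n + c b n) * B X ((bracket ω ^ n) Y) = 0 by linear_combination h
    by_cases hab : ζ ^ (a + b) = 1
    · have hcoeff : c a n * (-1) ^ n + c b n = 0 := by
        refine coeff_reflection hr (hsum a ha ⟨X, hX0, hX⟩) (hsum b hb ⟨Y, hY0, hY⟩) ?_ n
        intro w
        obtain ⟨k, hk⟩ := hζp.dvd_of_pow_eq_one _ hab
        have hk2 : k < 2 := by
          by_contra! hk2
          have := Nat.mul_le_mul_left N hk2
          omega
        interval_cases k
        · have ha0 : a = 0 := by omega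
          have hb0 : b = 0 := by omega
          simp only [ha0, hb0, if_true, neg_div, coth_neg, div_neg]
          ring
        · have ha0 : a ≠ 0 := by omega
          have hb0 : b ≠ 0 := by omega
          simp only [ha0, hb0, if_false]
          rw [coth_shift_reflect hN0 q a b (by omega), mul_neg]
      rw [hcoeff, zero_mul]
    · have h := hμB X ((bracket ω ^ n) Y)
      rw [hX, hpow_eig ω hω b Y hY n] at h
      simp only [map_smul, LinearMap.smul_apply, smul_eq_mul] at h
      have h' : (ζ ^ (a + b) - 1) * B X ((bracket ω ^ n) Y) = 0 := by
        rw [pow_add]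
        linear_combination h
      rw [(mul_eq_zero.1 h').resolve_left (sub_ne_zero.2 hab), mul_zero]
  have hequiv_eig : ∀ T, μ T = T → ∀ ω, μ ω = ω → ‖bracket ω‖ < r → ∀ a < N, ∀ X,
      μ X = ζ ^ a • X → HasDerivAt (fun t : ℂ => ρ (ω + t • bracket T ω) X)
        (bracket T (ρ ω X) - ρ ω (bracket T X)) 0 := by
    intro T hT ω hω hωr a ha X hX
    by_cases hX0 : X = 0
    · simpa [hX0] using hasDerivAt_const (0 : ℂ) (0 : G)
    have hca : ∀ w : ℂ, ‖w‖ < r → w ≠ 0 → Summable fun n => ‖c a n * w ^ n‖ :=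
      fun w hw hw0 => (hc a ha ⟨X, hX0, hX⟩ w hw fun _ => hw0).1
    let F : (G →L[ℂ] G) → (G →L[ℂ] G) := FormalMultilinearSeries.ofScalarsSum (c a)
    have hρF : ∀ ω, μ ω = ω → ‖bracket ω‖ < r → ∀ Z, μ Z = ζ ^ a • Z →
        ρ ω Z = F (bracket ω) Z := by
      intro ω hω hωr Z hZ
      refine (hρ ω hω hωr a ha Z hZ).unique ?_
      have h := (ContinuousLinearMap.apply ℂ G Z).hasSum (hasSum_ofScalarsSum hr hca hωr)
      simpa only [ContinuousLinearMap.apply_apply, smul_apply] using h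
    have hbr : bracket (bracket T ω) = bracket T * bracket ω - bracket ω * bracket T := by
      ext z
      simp [hleib T ω z]
    have hTω : μ (bracket T ω) = bracket T ω := by rw [hμbr, hT, hω]
    have hTX : μ (bracket T X) = ζ ^ a • bracket T X := by rw [hμbr, hT, hX, map_smul]
    have hderiv := (ContinuousLinearMap.apply ℂ G X).hasFDerivAt.comp_hasDerivAt (0 : ℂ)
      (hasDerivAt_ofScalarsSum_commutator hr hca hωr (bracket T))
    rw [hρF ω hω hωr X hX, hρF ω hω hωr _ hTX]
    refine hderiv.congr_of_eventuallyEq ?_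
    have hnear : ∀ᶠ t in 𝓝 (0 : ℂ), ‖bracket (ω + t • bracket T ω)‖ < r := by
      have hcont : Continuous fun t : ℂ => ‖bracket (ω + t • bracket T ω)‖ :=
        (bracket.continuous.comp
          (continuous_const.add (continuous_id.smul continuous_const))).norm
      exact hcont.continuousAt.eventually_lt continuousAt_const (by simpa using hωr)
    filter_upwards [hnear] with t ht
    rw [hρF _ (by rw [map_add, map_smul, hω, hTω]) ht X hX, map_add, map_smul, hbr]
    rfl
  refine ⟨fun ω hω hωr X Y => ?_, fun T hT ω hω hωr X => ?_⟩
  · refine induction_on_eigenvectors μ hμN hζp hN0 (P := fun X => B (ρ ω X) Y = -B X (ρ ω Y))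
      (by simp) (fun x y hx hy => ?_) (fun a ha X hX => ?_) X
    · simp only [map_add, LinearMap.add_apply, hx, hy]
      ring
    · refine induction_on_eigenvectors μ hμN hζp hN0 (P := fun Y => B (ρ ω X) Y = -B X (ρ ω Y))
        (by simp) (fun x y hx hy => ?_) (fun b hb Y hY => ?_) Y
      · simp only [map_add, hx, hy]
        ring
      · exact hantisymm_eig ω hω hωr a ha X hX b hb Y hY
  · refine (hDρ (bracket T ω) (by rw [hμbr, hT, hω]) ω hω hωr X).unique ?_
    refine induction_on_eigenvectors μ hμN hζp hN0
      (P := fun X => HasDerivAt (fun t : ℂ => ρ (ω + t • bracket T ω) X)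
        (bracket T (ρ ω X) - ρ ω (bracket T X)) 0)
      (by simpa using hasDerivAt_const (0 : ℂ) (0 : G)) (fun x y hx hy => ?_)
      (fun a ha X hX => hequiv_eig T hT ω hω hωr a ha X hX) X
    simpa only [map_add, add_sub_add_comm, Pi.add_def] using hx.add hy
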